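/- (Theorem 3) Let E¹ and E² be informationally complete POVMs on ℂ². Then the supremum, over all rank-one orthogonal projections ρ and X on ℂ² (pure single-qubit states and pure-state projections), of ‖2 · ρᵀ ⊗ X‖²_{E¹⊗E²} is at least 9. Moreover, this optimal value 9 is attained when E¹ and E² are both the Pauli-6 (octahedron) POVM, i.e., when the measurement is the tensor product of two octahedron measurements. -/

import Mathlib

open Matrix
open scoped Kronecker ComplexOrder

def IsPOVM {n ι : Type*} [Fintype n] [DecidableEq n] [Fintype ι]
    (E : ι → Matrix n n ℂ) : Prop :=
  (∀ k, (E k).PosSemidef) ∧ ∑ k, E k = 1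

noncomputable def frameOp {n ι : Type*} [Fintype n] [DecidableEq n] [Fintype ι]
    (E : ι → Matrix n n ℂ) : Matrix n n ℂ →ₗ[ℂ] Matrix n n ℂ where
  toFun A := ∑ k, (A * E k).trace • E k
  map_add' A B := by
    simp [add_mul, Matrix.trace_add, add_smul, Finset.sum_add_distrib]
  map_smul' c A := by
    simp [Matrix.smul_mul, Matrix.trace_smul, smul_smul, Finset.smul_sum]

open Classical in
noncomputable def lambdaMax {n : Type*} [Fintype n] [DecidableEq n]
    (A : Matrix n n ℂ) : ℝ :=
  if h : A.IsHermitian then ⨆ k, h.eigenvalues k else 0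

noncomputable def shadowNormSq {n ι : Type*} [Fintype n] [DecidableEq n] [Fintype ι]
    (E sh : ι → Matrix n n ℂ) (X : Matrix n n ℂ) : ℝ :=
  lambdaMax (∑ k, (((sh k * X).trace.re) ^ 2 : ℝ) • E k)

noncomputable def sigX : Matrix (Fin 2) (Fin 2) ℂ := !![0, 1; 1, 0]
noncomputable def sigY : Matrix (Fin 2) (Fin 2) ℂ := !![0, -Complex.I; Complex.I, 0]
noncomputable def sigZ : Matrix (Fin 2) (Fin 2) ℂ := !![1, 0; 0, -1]

/-- The Pauli-6 (octahedron) POVM on ℂ²: effects `(1/6)(I + n·σ)`, `n ∈ {±e_x, ±e_y, ±e_z}`. -/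
noncomputable def pauli6 : Fin 6 → Matrix (Fin 2) (Fin 2) ℂ :=
  ![(1/6 : ℂ) • (1 + sigX), (1/6 : ℂ) • (1 - sigX),
    (1/6 : ℂ) • (1 + sigY), (1/6 : ℂ) • (1 - sigY),
    (1/6 : ℂ) • (1 + sigZ), (1/6 : ℂ) • (1 - sigZ)]

theorem posSemidef_of_isHermitian_of_sq {n : Type*} [Fintype n] [DecidableEq n]
    {P : Matrix n n ℂ} (hP : P.IsHermitian) (hPP : P * P = P) : P.PosSemidef := by
  have h := posSemidef_conjTranspose_mul_self P
  rwa [hP.eq, hPP] at h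

theorem one_sub_posSemidef {n : Type*} [Fintype n] [DecidableEq n]
    {P : Matrix n n ℂ} (hP : P.IsHermitian) (hPP : P * P = P) : (1 - P).PosSemidef := by
  refine posSemidef_of_isHermitian_of_sq (isHermitian_one.sub hP) ?_
  simp [sub_mul, mul_sub, hPP]

theorem trace_eq_rank_of_idempotent {n : Type*} [Fintype n] [DecidableEq n]
    {P : Matrix n n ℂ} (hPP : P * P = P) : P.trace = P.rank := by
  have hi : IsIdempotentElem (toLin' P) := by
    unfold IsIdempotentElem
    rw [Module.End.mul_eq_comp, ← toLin'_mul, hPP]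
  have h := LinearMap.IsProj.trace (LinearMap.IsIdempotentElem.isProj_range _ hi)
  rw [trace_toLin'_eq] at h
  rw [h]
  rfl

theorem trace_mul_re_le_lambdaMax {n : Type*} [Fintype n] [DecidableEq n]
    {A P : Matrix n n ℂ} (hA : A.IsHermitian) (hP : P.PosSemidef) (hP1 : P.trace = 1) :
    (A * P).trace.re ≤ lambdaMax A := by
  classical
  rw [lambdaMax, dif_pos hA]
  have hD := hA.spectral_theorem
  rw [Unitary.conjStarAlgAut_apply] at hD
  set U : Matrix n n ℂ := (hA.eigenvectorUnitary : Matrix n n ℂ) with hU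
  set Q := star U * P * U with hQ
  have hQpos : Q.PosSemidef := hP.conjTranspose_mul_mul_same U
  have hUU : U * star U = 1 := Unitary.mul_star_self_of_mem hA.eigenvectorUnitary.2
  have hQ1 : Q.trace = 1 := by
    rw [hQ, trace_mul_cycle, hUU, one_mul, hP1]
  have hAP : (A * P).trace = ∑ i, (hA.eigenvalues i : ℂ) * Q i i := by
    conv_lhs => rw [hD]
    rw [Matrix.mul_assoc, Matrix.trace_mul_comm, ← Matrix.mul_assoc,
      Matrix.trace_mul_comm, ← hQ]
    simp [Matrix.trace, Matrix.diagonal_mul]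
  have hQ0 : ∀ i, 0 ≤ (Q i i).re := fun i => (Complex.le_def.1 (hQpos.diag_nonneg (i := i))).1
  have hQs : ∑ i, (Q i i).re = 1 := by
    have := congrArg Complex.re hQ1
    simpa [Matrix.trace] using this
  rw [hAP, Complex.re_sum]
  calc ∑ i, ((hA.eigenvalues i : ℂ) * Q i i).re
      = ∑ i, hA.eigenvalues i * (Q i i).re := by simp
    _ ≤ ∑ i, (⨆ k, hA.eigenvalues k) * (Q i i).re := by
      gcongr with i
      · exact hQ0 i
      · exact le_ciSup (Set.finite_range _).bddAbove i
    _ = _ := by rw [← Finset.mul_sum, hQs, mul_one]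

theorem lambdaMax_le {n : Type*} [Fintype n] [DecidableEq n] [Nonempty n]
    {A : Matrix n n ℂ} {c : ℝ} (hA : A.IsHermitian) (h : (c • (1 : Matrix n n ℂ) - A).PosSemidef) :
    lambdaMax A ≤ c := by
  classical
  rw [lambdaMax, dif_pos hA]
  refine ciSup_le fun i => ?_
  have h1 := h.dotProduct_mulVec_nonneg (hA.eigenvectorBasis i).ofLp
  have h2 : star (hA.eigenvectorBasis i).ofLp ⬝ᵥ (hA.eigenvectorBasis i).ofLp = 1 := by
    have := (hA.eigenvectorBasis).orthonormal.1 i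
    have h3 := inner_self_eq_norm_sq_to_K (𝕜 := ℂ) (hA.eigenvectorBasis i)
    rw [this, EuclideanSpace.inner_eq_star_dotProduct, dotProduct_comm] at h3
    simpa using h3
  rw [sub_mulVec, dotProduct_sub, hA.mulVec_eigenvectorBasis, smul_mulVec, one_mulVec,
    dotProduct_smul, dotProduct_smul, h2] at h1
  have := (Complex.le_def.1 h1).1
  simp at this
  linarith

theorem norm_entry_le_one {n : Type*} [Fintype n] [DecidableEq n]
    {P : Matrix n n ℂ} (hP : P.IsHermitian) (hPP : P * P = P) (i j : n) : ‖P i j‖ ≤ 1 := by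
  have hd : ∀ i, (P i i).re = ∑ j, ‖P i j‖ ^ 2 := by
    intro i
    have h := congrFun (congrFun hPP i) i
    rw [← h, mul_apply, Complex.re_sum]
    refine Finset.sum_congr rfl fun j _ => ?_
    rw [← hP.apply j i]
    rw [Complex.star_def, Complex.mul_conj, Complex.ofReal_re, Complex.normSq_eq_norm_sq]
  have hle : ∀ j, ‖P i j‖ ^ 2 ≤ (P i i).re := fun j => by
    rw [hd i]
    exact Finset.single_le_sum (f := fun j => ‖P i j‖ ^ 2) (fun _ _ => by positivity)
      (Finset.mem_univ j)
  have h1 := hle i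
  have h2 := hle j
  have h3 := Complex.re_le_norm (P i i)
  have h4 : ‖P i i‖ ≤ 1 := by
    nlinarith [norm_nonneg (P i i)]
  nlinarith [norm_nonneg (P i j)]

theorem isHermitian_sum_real_smul {n ι : Type*} [Fintype n] [DecidableEq n] [Fintype ι]
    {E : ι → Matrix n n ℂ} (hE : ∀ k, (E k).IsHermitian) (c : ι → ℝ) :
    (∑ k, c k • E k).IsHermitian := by
  unfold IsHermitian
  rw [conjTranspose_sum]
  refine Finset.sum_congr rfl fun k _ => ?_
  rw [conjTranspose_smul, (hE k).eq]
  simp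

theorem IsPOVM.shadowNormSq_le {n ι : Type*} [Fintype n] [DecidableEq n] [Nonempty n] [Fintype ι]
    {E : ι → Matrix n n ℂ} (hE : IsPOVM E) (sh : ι → Matrix n n ℂ) (X : Matrix n n ℂ) {c : ℝ}
    (hc : ∀ k, ((sh k * X).trace.re) ^ 2 ≤ c) : shadowNormSq E sh X ≤ c := by
  refine lambdaMax_le (isHermitian_sum_real_smul (fun k => (hE.1 k).1) _) ?_
  rw [← hE.2, Finset.smul_sum, ← Finset.sum_sub_distrib]
  refine posSemidef_sum _ fun k _ => ?_
  rw [← sub_smul]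
  exact (hE.1 k).smul (sub_nonneg.2 (hc k))

theorem IsPOVM.exists_shadowNormSq_le {n ι : Type*} [Fintype n] [DecidableEq n] [Nonempty n]
    [Fintype ι] {E : ι → Matrix n n ℂ} (hE : IsPOVM E) (sh : ι → Matrix n n ℂ) :
    ∃ c : ℝ, ∀ P : Matrix n n ℂ, P.IsHermitian → P * P = P →
      shadowNormSq E sh ((2 : ℂ) • P) ≤ c := by
  refine ⟨∑ k, (2 * ∑ i, ∑ j, ‖sh k i j‖) ^ 2, fun P hP hPP => hE.shadowNormSq_le _ _ fun k => ?_⟩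
  refine le_trans ?_ (Finset.single_le_sum (f := fun k => (2 * ∑ i, ∑ j, ‖sh k i j‖) ^ 2)
    (fun _ _ => by positivity) (Finset.mem_univ k))
  rw [← sq_abs]
  gcongr
  refine (Complex.abs_re_le_norm _).trans ?_
  rw [Matrix.mul_smul, trace_smul, norm_smul, Complex.norm_ofNat]
  gcongr
  refine (norm_sum_le _ _).trans (Finset.sum_le_sum fun i _ => ?_)
  rw [diag_apply, mul_apply]
  refine (norm_sum_le _ _).trans (Finset.sum_le_sum fun j _ => ?_)
  rw [norm_mul]
  exact mul_le_of_le_one_right (norm_nonneg _) (norm_entry_le_one hP hPP j i)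

theorem IsPOVM.kronecker {m n ι κ : Type*} [Fintype m] [DecidableEq m] [Fintype n] [DecidableEq n]
    [Fintype ι] [Fintype κ] {E : ι → Matrix m m ℂ} {F : κ → Matrix n n ℂ}
    (hE : IsPOVM E) (hF : IsPOVM F) : IsPOVM fun k : ι × κ => E k.1 ⊗ₖ F k.2 := by
  refine ⟨fun k => (hE.1 k.1).kronecker (hF.1 k.2), ?_⟩
  rw [← one_kronecker_one, ← hE.2, ← hF.2]
  ext ⟨i, i'⟩ ⟨j, j'⟩
  simp [Matrix.sum_apply, Fintype.sum_prod_type, Finset.sum_mul_sum]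

theorem frameOp_kronecker {m n ι κ : Type*} [Fintype m] [DecidableEq m] [Fintype n] [DecidableEq n]
    [Fintype ι] [Fintype κ] (E : ι → Matrix m m ℂ) (F : κ → Matrix n n ℂ)
    (A : Matrix m m ℂ) (B : Matrix n n ℂ) :
    frameOp (fun k : ι × κ => E k.1 ⊗ₖ F k.2) (A ⊗ₖ B) = frameOp E A ⊗ₖ frameOp F B := by
  ext ⟨i, i'⟩ ⟨j, j'⟩
  simp only [frameOp, LinearMap.coe_mk, AddHom.coe_mk, Matrix.sum_apply, Matrix.smul_apply,
    ← mul_kronecker_mul, trace_kronecker, kronecker_apply, Fintype.sum_prod_type,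
    Finset.sum_mul_sum, smul_eq_mul]
  refine Finset.sum_congr rfl fun _ _ => Finset.sum_congr rfl fun _ _ => by ring

theorem frameOp_kronecker_injective {m n ι κ : Type*} [Fintype m] [DecidableEq m]
    [Fintype n] [DecidableEq n] [Fintype ι] [Fintype κ]
    {E : ι → Matrix m m ℂ} {F : κ → Matrix n n ℂ}
    (hE : Function.Surjective (frameOp E)) (hF : Function.Surjective (frameOp F)) :
    Function.Injective (frameOp fun k : ι × κ => E k.1 ⊗ₖ F k.2) := by
  rw [LinearMap.injective_iff_surjective, ← LinearMap.range_eq_top, eq_top_iff]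
  intro M _
  rw [matrix_eq_sum_single M]
  refine Submodule.sum_mem _ fun i _ => Submodule.sum_mem _ fun j _ => ?_
  obtain ⟨A, hA⟩ := hE (single i.1 j.1 (M i j))
  obtain ⟨B, hB⟩ := hF (single i.2 j.2 1)
  refine ⟨A ⊗ₖ B, ?_⟩
  rw [frameOp_kronecker, hA, hB, single_kronecker_single, mul_one]

theorem frameOp_conjTranspose {n ι : Type*} [Fintype n] [DecidableEq n] [Fintype ι]
    {E : ι → Matrix n n ℂ} (hE : ∀ k, (E k).IsHermitian) (A : Matrix n n ℂ) :
    frameOp E Aᴴ = (frameOp E A)ᴴ := by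
  simp only [frameOp, LinearMap.coe_mk, AddHom.coe_mk, conjTranspose_sum, conjTranspose_smul]
  refine Finset.sum_congr rfl fun k _ => ?_
  rw [← trace_conjTranspose, conjTranspose_mul, (hE k).eq, trace_mul_comm]

theorem trace_frameOp_mul {n ι : Type*} [Fintype n] [DecidableEq n] [Fintype ι]
    (E : ι → Matrix n n ℂ) (A B : Matrix n n ℂ) :
    (frameOp E A * B).trace = (A * frameOp E B).trace := by
  simp only [frameOp, LinearMap.coe_mk, AddHom.coe_mk, Finset.sum_mul, Finset.mul_sum,
    trace_sum, smul_mul, Matrix.mul_smul, trace_smul, smul_eq_mul]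
  refine Finset.sum_congr rfl fun k _ => ?_
  rw [trace_mul_comm (E k) B, mul_comm]

theorem sum_trace_shadow_smul {n ι : Type*} [Fintype n] [DecidableEq n] [Fintype ι]
    {E sh : ι → Matrix n n ℂ} (hE : Function.Surjective (frameOp E))
    (hsh : ∀ k, frameOp E (sh k) = E k) (A : Matrix n n ℂ) :
    ∑ k, (sh k * A).trace • E k = A := by
  obtain ⟨B, rfl⟩ := hE A
  simp only [← trace_frameOp_mul, hsh]
  simp only [frameOp, LinearMap.coe_mk, AddHom.coe_mk, trace_mul_comm B]

theorem Matrix.IsHermitian.trace_mul_im {n : Type*} [Fintype n] {A B : Matrix n n ℂ}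
    (hA : A.IsHermitian) (hB : B.IsHermitian) : (A * B).trace.im = 0 := by
  rw [← Complex.conj_eq_iff_im, ← Complex.star_def, ← trace_conjTranspose, conjTranspose_mul,
    hA.eq, hB.eq, trace_mul_comm]

theorem isHermitian_sigX : sigX.IsHermitian := by
  ext i j; fin_cases i <;> fin_cases j <;> simp [sigX]

theorem isHermitian_sigY : sigY.IsHermitian := by
  ext i j; fin_cases i <;> fin_cases j <;> simp [sigY]

theorem isHermitian_sigZ : sigZ.IsHermitian := by
  ext i j; fin_cases i <;> fin_cases j <;> simp [sigZ]

theorem sigX_mul_self : sigX * sigX = 1 := by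
  ext i j; fin_cases i <;> fin_cases j <;> simp [sigX]

theorem sigY_mul_self : sigY * sigY = 1 := by
  ext i j; fin_cases i <;> fin_cases j <;> simp [sigY]

theorem sigZ_mul_self : sigZ * sigZ = 1 := by
  ext i j; fin_cases i <;> fin_cases j <;> simp [sigZ]

theorem trace_sigX : sigX.trace = 0 := by simp [sigX, trace_fin_two]

theorem trace_sigY : sigY.trace = 0 := by simp [sigY, trace_fin_two]

theorem trace_sigZ : sigZ.trace = 0 := by simp [sigZ, trace_fin_two]

theorem half_one_add_projection {σ : Matrix (Fin 2) (Fin 2) ℂ} (hσ : σ.IsHermitian)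
    (hσσ : σ * σ = 1) (hσ0 : σ.trace = 0) :
    ((1 / 2 : ℂ) • (1 + σ)).IsHermitian ∧
      ((1 / 2 : ℂ) • (1 + σ)) * ((1 / 2 : ℂ) • (1 + σ)) = (1 / 2 : ℂ) • (1 + σ) ∧
      ((1 / 2 : ℂ) • (1 + σ)).rank = 1 := by
  have h2 : ((1 / 2 : ℂ) • (1 + σ)) * ((1 / 2 : ℂ) • (1 + σ)) = (1 / 2 : ℂ) • (1 + σ) := by
    rw [smul_mul_smul, mul_add, add_mul, add_mul, hσσ, one_mul, mul_one, one_mul]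
    module
  refine ⟨?_, h2, ?_⟩
  · unfold IsHermitian
    rw [conjTranspose_smul, conjTranspose_add, conjTranspose_one, hσ.eq]
    simp
  · have := trace_eq_rank_of_idempotent h2
    rw [trace_smul, trace_add, trace_one, hσ0] at this
    have h3 : ((((1 / 2 : ℂ) • (1 + σ)).rank : ℕ) : ℂ) = (1 : ℕ) := by
      rw [← this]
      norm_num
    exact_mod_cast h3

theorem Matrix.PosSemidef.bloch_le {E : Matrix (Fin 2) (Fin 2) ℂ} (hE : E.PosSemidef) :
    0 ≤ E.trace.re ∧
      (E * sigX).trace.re ^ 2 + (E * sigY).trace.re ^ 2 + (E * sigZ).trace.re ^ 2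
        ≤ E.trace.re ^ 2 := by
  have ht := (Complex.le_def.1 hE.trace_nonneg).1
  refine ⟨ht, ?_⟩
  have hd := (Complex.le_def.1 hE.det_nonneg).1
  have h10 : E 1 0 = star (E 0 1) := (hE.1.apply 1 0).symm
  have h00 := congrArg Complex.im (hE.1.apply 0 0)
  have h11 := congrArg Complex.im (hE.1.apply 1 1)
  simp at h00 h11
  have h00' : (E 0 0).im = 0 := by linarith
  have h11' : (E 1 1).im = 0 := by linarith
  rw [det_fin_two, h10] at hd
  simp [h00', h11'] at hd
  simp [trace_fin_two, mul_apply, Fin.sum_univ_two, sigX, sigY, sigZ, h10]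
  nlinarith

/-- The linear lower bound on the octahedral average of `(r + s·x)² (e + f·x)`
that is tight at `r = 1`, `s = 3f/e`. -/
theorem octahedral_average_ge {e f₁ f₂ f₃ : ℝ} (r s₁ s₂ s₃ : ℝ) (he : 0 ≤ e)
    (hf : f₁ ^ 2 + f₂ ^ 2 + f₃ ^ 2 ≤ e ^ 2) :
    24 * (r * e) + 16 * (s₁ * f₁ + s₂ * f₂ + s₃ * f₃) - 36 * e ≤
      6 * r ^ 2 * e + 2 * e * (s₁ ^ 2 + s₂ ^ 2 + s₃ ^ 2)
        + 4 * r * (s₁ * f₁ + s₂ * f₂ + s₃ * f₃) := by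
  rcases he.eq_or_lt with rfl | he
  · have h1 : f₁ = 0 := by nlinarith [sq_nonneg f₁, sq_nonneg f₂, sq_nonneg f₃]
    have h2 : f₂ = 0 := by nlinarith [sq_nonneg f₁, sq_nonneg f₂, sq_nonneg f₃]
    have h3 : f₃ = 0 := by nlinarith [sq_nonneg f₁, sq_nonneg f₂, sq_nonneg f₃]
    simp [h1, h2, h3]
  · rw [← sub_nonneg]
    refine nonneg_of_mul_nonneg_right (a := e) ?_ he
    have key : e * (6 * r ^ 2 * e + 2 * e * (s₁ ^ 2 + s₂ ^ 2 + s₃ ^ 2)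
        + 4 * r * (s₁ * f₁ + s₂ * f₂ + s₃ * f₃)
        - (24 * (r * e) + 16 * (s₁ * f₁ + s₂ * f₂ + s₃ * f₃) - 36 * e)) =
        2 * ((e * s₁ - (4 - r) * f₁) ^ 2 + (e * s₂ - (4 - r) * f₂) ^ 2
          + (e * s₃ - (4 - r) * f₃) ^ 2) + 4 * e ^ 2 * (r - 1) ^ 2
          + 2 * (4 - r) ^ 2 * (e ^ 2 - (f₁ ^ 2 + f₂ ^ 2 + f₃ ^ 2)) := by ring
    rw [key]
    have := sub_nonneg.2 hf
    positivity

theorem trace_real_smul_sum_mul_re {n ι : Type*} [Fintype n] [DecidableEq n] [Fintype ι]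
    (E : ι → Matrix n n ℂ) (c : ι → ℝ) (X : Matrix n n ℂ) :
    ((∑ k, c k • E k) * X).trace.re = ∑ k, c k * (E k * X).trace.re := by
  rw [Finset.sum_mul, trace_sum, Complex.re_sum]
  refine Finset.sum_congr rfl fun k _ => ?_
  rw [smul_mul, trace_smul, Complex.smul_re, smul_eq_mul]

/-- A qubit measurement has a rank-one projection whose shadow variance in its own state
is at least `3/2`. -/
theorem IsPOVM.exists_projection_ge {ι : Type*} [Fintype ι]
    {E sh : ι → Matrix (Fin 2) (Fin 2) ℂ} (hE : IsPOVM E)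
    (hC : Function.Surjective (frameOp E))
    (hsh : ∀ k, frameOp E (sh k) = E k) (hherm : ∀ k, (sh k).IsHermitian) :
    ∃ X : Matrix (Fin 2) (Fin 2) ℂ, X.IsHermitian ∧ X * X = X ∧ X.rank = 1 ∧
      3 / 2 ≤ ((∑ k, (((sh k * X).trace.re) ^ 2 : ℝ) • E k) * X).trace.re := by
  by_contra! hcon
  have hdual : ∀ σ : Matrix (Fin 2) (Fin 2) ℂ, σ.IsHermitian →
      ∑ k, (sh k * σ).trace.re * (E k * σ).trace.re = (σ * σ).trace.re := by
    intro σ hσ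
    conv_rhs => rw [← congrArg (· * σ) (sum_trace_shadow_smul hC hsh σ)]
    rw [Finset.sum_mul, trace_sum, Complex.re_sum]
    refine Finset.sum_congr rfl fun k _ => ?_
    rw [smul_mul, trace_smul, smul_eq_mul, Complex.mul_re, (hherm k).trace_mul_im hσ]
    simp
  have hlt : ∀ σ : Matrix (Fin 2) (Fin 2) ℂ, σ.IsHermitian → σ * σ = 1 → σ.trace = 0 →
      ∑ k, ((sh k).trace.re + (sh k * σ).trace.re) ^ 2 *
        ((E k).trace.re + (E k * σ).trace.re) < 12 := by
    intro σ hσ hσσ hσ0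
    obtain ⟨h1, h2, h3⟩ := half_one_add_projection hσ hσσ hσ0
    have h := hcon _ h1 h2 h3
    rw [trace_real_smul_sum_mul_re] at h
    have hre : ∀ A : Matrix (Fin 2) (Fin 2) ℂ, (A * ((1 / 2 : ℂ) • (1 + σ))).trace.re =
        (A.trace.re + (A * σ).trace.re) / 2 := by
      intro A
      rw [Matrix.mul_smul, trace_smul, mul_add, trace_add, mul_one, smul_eq_mul]
      simp
      ring
    simp only [hre] at h
    calc _ = 8 * ∑ k, (((sh k).trace.re + (sh k * σ).trace.re) / 2) ^ 2 *
          (((E k).trace.re + (E k * σ).trace.re) / 2) := by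
          rw [Finset.mul_sum]
          exact Finset.sum_congr rfl fun k _ => by ring
      _ < 12 := by linarith
  have hpm : ∀ σ : Matrix (Fin 2) (Fin 2) ℂ, σ.IsHermitian → σ * σ = 1 → σ.trace = 0 →
      ∑ k, (2 * (sh k).trace.re ^ 2 * (E k).trace.re
        + 2 * (E k).trace.re * (sh k * σ).trace.re ^ 2
        + 4 * (sh k).trace.re * ((sh k * σ).trace.re * (E k * σ).trace.re)) < 24 := by
    intro σ hσ hσσ hσ0
    have h1 := hlt σ hσ hσσ hσ0
    have h2 := hlt (-σ) hσ.neg (by simpa using hσσ) (by simpa using hσ0)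
    have h3 := add_lt_add h1 h2
    rw [← Finset.sum_add_distrib] at h3
    calc _ = _ := Finset.sum_congr rfl fun k _ => by
          simp only [mul_neg, trace_neg, Complex.neg_re]
          ring
      _ < _ := h3
      _ = 24 := by norm_num
  have hsum := add_lt_add (add_lt_add (hpm _ isHermitian_sigX sigX_mul_self trace_sigX)
    (hpm _ isHermitian_sigY sigY_mul_self trace_sigY))
    (hpm _ isHermitian_sigZ sigZ_mul_self trace_sigZ)
  rw [← Finset.sum_add_distrib, ← Finset.sum_add_distrib] at hsum
  have hX := hdual _ isHermitian_sigX
  have hY := hdual _ isHermitian_sigY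
  have hZ := hdual _ isHermitian_sigZ
  have hI := hdual 1 isHermitian_one
  rw [sigX_mul_self] at hX
  rw [sigY_mul_self] at hY
  rw [sigZ_mul_self] at hZ
  simp only [mul_one] at hI
  have hT : ∑ k, (E k).trace.re = 2 := by
    rw [← Complex.re_sum, ← trace_sum, hE.2]
    simp
  have h1 : (1 : Matrix (Fin 2) (Fin 2) ℂ).trace.re = 2 := by simp
  rw [h1] at hX hY hZ hI
  have hge := Finset.sum_le_sum fun k (_ : k ∈ Finset.univ) =>
    octahedral_average_ge ((sh k).trace.re) ((sh k * sigX).trace.re) ((sh k * sigY).trace.re)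
      ((sh k * sigZ).trace.re) (hE.1 k).bloch_le.1 (hE.1 k).bloch_le.2
  refine absurd hsum (not_lt.2 ?_)
  simp only [Finset.sum_sub_distrib, Finset.sum_add_distrib, ← Finset.mul_sum,
    hX, hY, hZ, hI, hT] at hge
  refine le_trans (by norm_num at hge ⊢; exact hge) (le_of_eq ?_)
  simp only [← Finset.sum_add_distrib]
  exact Finset.sum_congr rfl fun k _ => by ring

theorem sum_kronecker_shadow {m n ι κ : Type*} [Fintype m] [DecidableEq m] [Fintype n]
    [DecidableEq n] [Fintype ι] [Fintype κ]
    (E sh : ι → Matrix m m ℂ) (F sh' : κ → Matrix n n ℂ) (hsh : ∀ k, (sh k).IsHermitian)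
    {A : Matrix m m ℂ} (B : Matrix n n ℂ) (hA : A.IsHermitian) :
    ∑ k : ι × κ, ((((sh k.1 ⊗ₖ sh' k.2) * ((2 : ℂ) • (A ⊗ₖ B))).trace.re) ^ 2 : ℝ) •
        (E k.1 ⊗ₖ F k.2) =
      (4 : ℝ) • ((∑ k, (((sh k * A).trace.re) ^ 2 : ℝ) • E k) ⊗ₖ
        (∑ k, (((sh' k * B).trace.re) ^ 2 : ℝ) • F k)) := by
  have hc : ∀ k : ι × κ, (((sh k.1 ⊗ₖ sh' k.2) * ((2 : ℂ) • (A ⊗ₖ B))).trace.re) ^ 2 =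
      4 * ((sh k.1 * A).trace.re ^ 2 * (sh' k.2 * B).trace.re ^ 2) := by
    intro k
    rw [Matrix.mul_smul, trace_smul, ← mul_kronecker_mul, trace_kronecker, smul_eq_mul]
    simp [(hsh k.1).trace_mul_im hA]
    ring
  simp only [hc]
  ext ⟨i, i'⟩ ⟨j, j'⟩
  simp only [Matrix.sum_apply, Matrix.smul_apply, kronecker_apply, Fintype.sum_prod_type,
    Finset.sum_mul_sum, Finset.smul_sum, Complex.real_smul]
  refine Finset.sum_congr rfl fun _ _ => Finset.sum_congr rfl fun _ _ => ?_
  push_cast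
  ring

theorem kronecker_trace_le_shadowNormSq {m n ι κ : Type*} [Fintype m] [DecidableEq m] [Fintype n]
    [DecidableEq n] [Fintype ι] [Fintype κ]
    {E sh : ι → Matrix m m ℂ} {F sh' : κ → Matrix n n ℂ} (hE : ∀ k, (E k).IsHermitian)
    (hF : ∀ k, (F k).IsHermitian) (hsh : ∀ k, (sh k).IsHermitian)
    {A : Matrix m m ℂ} {B : Matrix n n ℂ} (hA : A.IsHermitian) (hAA : A * A = A)
    (hA1 : A.rank = 1) (hB : B.IsHermitian) (hBB : B * B = B) (hB1 : B.rank = 1) :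
    4 * (((∑ k, (((sh k * A).trace.re) ^ 2 : ℝ) • E k) * A).trace.re *
        ((∑ k, (((sh' k * B).trace.re) ^ 2 : ℝ) • F k) * B).trace.re) ≤
      shadowNormSq (fun k : ι × κ => E k.1 ⊗ₖ F k.2) (fun k => sh k.1 ⊗ₖ sh' k.2)
        ((2 : ℂ) • (A ⊗ₖ B)) := by
  have hP : (A ⊗ₖ B).PosSemidef := (posSemidef_of_isHermitian_of_sq hA hAA).kronecker
    (posSemidef_of_isHermitian_of_sq hB hBB)
  have hP1 : (A ⊗ₖ B).trace = 1 := by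
    rw [trace_kronecker, trace_eq_rank_of_idempotent hAA, trace_eq_rank_of_idempotent hBB,
      hA1, hB1]
    simp
  have h := trace_mul_re_le_lambdaMax (isHermitian_sum_real_smul (E := fun k : ι × κ =>
    E k.1 ⊗ₖ F k.2) (fun k => by
      unfold IsHermitian
      rw [conjTranspose_kronecker, (hE k.1).eq, (hF k.2).eq])
    fun k => ((((sh k.1 ⊗ₖ sh' k.2) * ((2 : ℂ) • (A ⊗ₖ B))).trace.re) ^ 2 : ℝ)) hP hP1
  refine le_trans (le_of_eq ?_) h
  rw [sum_kronecker_shadow E sh F sh' hsh B hA, smul_mul, trace_smul, ← mul_kronecker_mul,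
    trace_kronecker]
  simp [(isHermitian_sum_real_smul hE _).trace_mul_im hA]

theorem exists_isHermitian_shadow {n ι : Type*} [Fintype n] [DecidableEq n] [Fintype ι]
    {E : ι → Matrix n n ℂ} (hE : ∀ k, (E k).IsHermitian) (hC : Function.Bijective (frameOp E)) :
    ∃ sh : ι → Matrix n n ℂ, (∀ k, frameOp E (sh k) = E k) ∧ ∀ k, (sh k).IsHermitian := by
  choose sh hsh using fun k => hC.2 (E k)
  refine ⟨sh, hsh, fun k => hC.1 ?_⟩
  rw [frameOp_conjTranspose hE, hsh, (hE k).eq]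

theorem isHermitian_pauli6 (k : Fin 6) : (pauli6 k).IsHermitian := by
  unfold IsHermitian
  fin_cases k <;>
    simp [pauli6, isHermitian_sigX.eq, isHermitian_sigY.eq, isHermitian_sigZ.eq]

theorem isHermitian_nine_smul_pauli6_sub_one (k : Fin 6) :
    ((9 : ℂ) • pauli6 k - 1).IsHermitian := by
  unfold IsHermitian
  rw [conjTranspose_sub, conjTranspose_smul, (isHermitian_pauli6 k).eq]
  simp

theorem pauli6_shadow_sum {X : Matrix (Fin 2) (Fin 2) ℂ} (hX : X.IsHermitian) (hXX : X * X = X)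
    (hX1 : X.rank = 1) :
    ∑ k, (((((9 : ℂ) • pauli6 k - 1) * X).trace.re) ^ 2 : ℝ) • pauli6 k =
      X + (1 / 2 : ℝ) • 1 := by
  have ht := trace_eq_rank_of_idempotent hXX
  rw [hX1, trace_fin_two] at ht
  have h10 : X 1 0 = star (X 0 1) := (hX.apply 1 0).symm
  have h00 := congrArg Complex.im (hX.apply 0 0)
  have hs := congrArg Complex.re (congrFun (congrFun hXX 0) 0)
  have htr := congrArg Complex.re ht
  have hti := congrArg Complex.im ht
  simp [mul_apply, Fin.sum_univ_two, h10] at h00 hs htr hti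
  have h00' : (X 0 0).im = 0 := by linarith
  have h11' : (X 1 1).im = 0 := by linarith
  have h11 : (X 1 1).re = 1 - (X 0 0).re := by linarith
  rw [h00'] at hs
  have hplus : ∀ σ : Matrix (Fin 2) (Fin 2) ℂ,
      (((9 : ℂ) • (1 / 6 : ℂ) • (1 + σ) - 1) * X).trace.re =
        1 / 2 + 3 / 2 * (σ * X).trace.re := by
    intro σ
    have hM : ((9 : ℂ) • (1 / 6 : ℂ) • (1 + σ) - 1) * X =
        (1 / 2 : ℝ) • X + (3 / 2 : ℝ) • (σ * X) := by
      simp only [sub_mul, smul_mul, add_mul, one_mul]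
      module
    rw [hM, trace_add, trace_smul, trace_smul, trace_eq_rank_of_idempotent hXX, hX1]
    simp
  have hminus : ∀ σ : Matrix (Fin 2) (Fin 2) ℂ,
      (((9 : ℂ) • (1 / 6 : ℂ) • (1 - σ) - 1) * X).trace.re =
        1 / 2 - 3 / 2 * (σ * X).trace.re := by
    intro σ
    rw [sub_eq_add_neg 1 σ, hplus, neg_mul, trace_neg, Complex.neg_re]
    ring
  have hx : (sigX * X).trace.re = 2 * (X 0 1).re := by
    rw [trace_fin_two, mul_apply, mul_apply, Fin.sum_univ_two, Fin.sum_univ_two]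
    simp [sigX, h10]
    ring
  have hy : (sigY * X).trace.re = -2 * (X 0 1).im := by
    rw [trace_fin_two, mul_apply, mul_apply, Fin.sum_univ_two, Fin.sum_univ_two]
    simp [sigY, h10]
    ring
  have hz : (sigZ * X).trace.re = 2 * (X 0 0).re - 1 := by
    rw [trace_fin_two, mul_apply, mul_apply, Fin.sum_univ_two, Fin.sum_univ_two]
    simp [sigZ, h11]
    ring
  rw [show (∑ k, (((((9 : ℂ) • pauli6 k - 1) * X).trace.re) ^ 2 : ℝ) • pauli6 k) = _ from
    Fin.sum_univ_six _]
  simp only [pauli6, Matrix.cons_val, hplus, hminus, hx, hy, hz]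
  ext i j
  apply Complex.ext <;> fin_cases i <;> fin_cases j <;>
    simp [sigX, sigY, sigZ, h10, h00', h11', h11, -Complex.ofReal_pow] <;>
    first | ring1 | linear_combination 3 * hs

theorem pauli6_shadowNormSq {A B : Matrix (Fin 2) (Fin 2) ℂ} (hA : A.IsHermitian)
    (hAA : A * A = A) (hA1 : A.rank = 1) (hB : B.IsHermitian) (hBB : B * B = B)
    (hB1 : B.rank = 1) :
    shadowNormSq (fun k : Fin 6 × Fin 6 => pauli6 k.1 ⊗ₖ pauli6 k.2)
      (fun k : Fin 6 × Fin 6 => ((9 : ℂ) • pauli6 k.1 - 1) ⊗ₖ ((9 : ℂ) • pauli6 k.2 - 1))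
      ((2 : ℂ) • (A ⊗ₖ B)) = 9 := by
  apply le_antisymm
  · unfold shadowNormSq
    refine lambdaMax_le (isHermitian_sum_real_smul (fun k => ?_) _) ?_
    · unfold IsHermitian
      rw [conjTranspose_kronecker, (isHermitian_pauli6 k.1).eq, (isHermitian_pauli6 k.2).eq]
    have hp := posSemidef_of_isHermitian_of_sq hA hAA
    have hA' := one_sub_posSemidef hA hAA
    have hB' := one_sub_posSemidef hB hBB
    have hpos := (((hA'.kronecker PosSemidef.one).smul (zero_le_two (α := ℝ))).add
      ((PosSemidef.one.kronecker hB').smul (zero_le_two (α := ℝ)))).add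
      (((hA'.kronecker PosSemidef.one).add (hp.kronecker hB')).smul (zero_le_four (α := ℝ)))
    have hsum := sum_kronecker_shadow pauli6 (fun k => (9 : ℂ) • pauli6 k - 1) pauli6
      (fun k => (9 : ℂ) • pauli6 k - 1) isHermitian_nine_smul_pauli6_sub_one B hA
    rw [pauli6_shadow_sum hA hAA hA1, pauli6_shadow_sum hB hBB hB1] at hsum
    have heq : (9 : ℝ) • (1 : Matrix (Fin 2 × Fin 2) (Fin 2 × Fin 2) ℂ) -
        (4 : ℝ) • ((A + (1 / 2 : ℝ) • 1) ⊗ₖ (B + (1 / 2 : ℝ) • 1)) =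
        (2 : ℝ) • ((1 - A) ⊗ₖ 1) + (2 : ℝ) • (1 ⊗ₖ (1 - B)) +
          (4 : ℝ) • ((1 - A) ⊗ₖ 1 + A ⊗ₖ (1 - B)) := by
      simp only [sub_eq_add_neg, ← neg_one_smul ℝ A, ← neg_one_smul ℝ B, add_kronecker,
        kronecker_add, smul_kronecker, kronecker_smul, one_kronecker_one]
      module
    rw [hsum, heq]
    exact hpos
  · have h := kronecker_trace_le_shadowNormSq (sh := fun k => (9 : ℂ) • pauli6 k - 1)
      (sh' := fun k => (9 : ℂ) • pauli6 k - 1) isHermitian_pauli6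
      isHermitian_pauli6 isHermitian_nine_smul_pauli6_sub_one hA hAA hA1 hB hBB hB1
    refine le_trans (le_of_eq ?_) h
    rw [pauli6_shadow_sum hA hAA hA1, pauli6_shadow_sum hB hBB hB1, add_mul, add_mul, hAA, hBB,
      smul_mul, smul_mul, one_mul, one_mul, trace_add, trace_add, trace_smul, trace_smul,
      trace_eq_rank_of_idempotent hAA, trace_eq_rank_of_idempotent hBB, hA1, hB1]
    norm_num

theorem isHermitian_transpose_projection {n : Type*} [Fintype n] [DecidableEq n]
    {P : Matrix n n ℂ} (hP : P.IsHermitian) (hPP : P * P = P) (hP1 : P.rank = 1) :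
    Pᵀ.IsHermitian ∧ Pᵀ * Pᵀ = Pᵀ ∧ Pᵀ.rank = 1 :=
  ⟨hP.transpose, by rw [← transpose_mul, hPP], by rw [rank_transpose, hP1]⟩

/-- Theorem 3: for any informationally complete POVMs `E¹, E²` on ℂ²,
the supremum over pure states `ρ` and rank-one projective observables `X` of
`‖2·ρᵀ ⊗ X‖²_{E¹⊗E²}` is at least `9`, and the value `9` is attained by the tensor
product of two Pauli-6 (octahedron) measurements. -/
theorem single_qubit_optimal_shadow_norm
    {N₁ N₂ : ℕ}
    (E₁ : Fin N₁ → Matrix (Fin 2) (Fin 2) ℂ)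
    (E₂ : Fin N₂ → Matrix (Fin 2) (Fin 2) ℂ)
    (hE₁ : IsPOVM E₁) (hE₂ : IsPOVM E₂)
    (hIC₁ : Function.Bijective (frameOp E₁))
    (hIC₂ : Function.Bijective (frameOp E₂))
    (shTot : Fin N₁ × Fin N₂ → Matrix (Fin 2 × Fin 2) (Fin 2 × Fin 2) ℂ)
    (hshTot : ∀ k, frameOp (fun k' : Fin N₁ × Fin N₂ => E₁ k'.1 ⊗ₖ E₂ k'.2) (shTot k)
        = E₁ k.1 ⊗ₖ E₂ k.2) :
    (9 ≤ sSup {x : ℝ | ∃ ρ X : Matrix (Fin 2) (Fin 2) ℂ,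
        ρ.IsHermitian ∧ ρ * ρ = ρ ∧ ρ.rank = 1 ∧
        X.IsHermitian ∧ X * X = X ∧ X.rank = 1 ∧
        x = shadowNormSq (fun k : Fin N₁ × Fin N₂ => E₁ k.1 ⊗ₖ E₂ k.2) shTot
              ((2 : ℂ) • (ρᵀ ⊗ₖ X))}) ∧
    sSup {x : ℝ | ∃ ρ X : Matrix (Fin 2) (Fin 2) ℂ,
        ρ.IsHermitian ∧ ρ * ρ = ρ ∧ ρ.rank = 1 ∧
        X.IsHermitian ∧ X * X = X ∧ X.rank = 1 ∧
        x = shadowNormSq (fun k : Fin 6 × Fin 6 => pauli6 k.1 ⊗ₖ pauli6 k.2)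
              (fun k : Fin 6 × Fin 6 =>
                ((9 : ℂ) • pauli6 k.1 - 1) ⊗ₖ ((9 : ℂ) • pauli6 k.2 - 1))
              ((2 : ℂ) • (ρᵀ ⊗ₖ X))} = 9 := by
  constructor
  · obtain ⟨sh₁, hsh₁, hh₁⟩ := exists_isHermitian_shadow (fun k => (hE₁.1 k).1) hIC₁
    obtain ⟨sh₂, hsh₂, hh₂⟩ := exists_isHermitian_shadow (fun k => (hE₂.1 k).1) hIC₂
    obtain rfl : shTot = fun k => sh₁ k.1 ⊗ₖ sh₂ k.2 := by
      funext k
      apply frameOp_kronecker_injective hIC₁.2 hIC₂.2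
      rw [hshTot, frameOp_kronecker, hsh₁, hsh₂]
    obtain ⟨A, hA, hAA, hA1, hAge⟩ := hE₁.exists_projection_ge hIC₁.2 hsh₁ hh₁
    obtain ⟨B, hB, hBB, hB1, hBge⟩ := hE₂.exists_projection_ge hIC₂.2 hsh₂ hh₂
    have hle := kronecker_trace_le_shadowNormSq (fun k => (hE₁.1 k).1) (fun k => (hE₂.1 k).1)
      hh₁ (sh' := sh₂) hA hAA hA1 hB hBB hB1
    obtain ⟨hT, hTT, hT1⟩ := isHermitian_transpose_projection hA hAA hA1
    refine le_trans (le_trans ?_ hle) (le_csSup ?_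
      ⟨Aᵀ, B, hT, hTT, hT1, hB, hBB, hB1, by rw [transpose_transpose]⟩)
    · nlinarith
    · obtain ⟨c, hc⟩ := (hE₁.kronecker hE₂).exists_shadowNormSq_le
        fun k : Fin N₁ × Fin N₂ => sh₁ k.1 ⊗ₖ sh₂ k.2
      refine ⟨c, ?_⟩
      rintro x ⟨ρ, X, hρ, hρρ, hρ1, hX, hXX, hX1, rfl⟩
      obtain ⟨hT, hTT, hT1⟩ := isHermitian_transpose_projection hρ hρρ hρ1
      refine hc _ ?_ ?_
      · unfold IsHermitian
        rw [conjTranspose_kronecker, hT.eq, hX.eq]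
      · rw [← mul_kronecker_mul, hTT, hXX]
  · refine Eq.trans (congrArg sSup ?_) (csSup_singleton (9 : ℝ))
    ext x
    constructor
    · rintro ⟨ρ, X, hρ, hρρ, hρ1, hX, hXX, hX1, rfl⟩
      obtain ⟨hT, hTT, hT1⟩ := isHermitian_transpose_projection hρ hρρ hρ1
      exact pauli6_shadowNormSq hT hTT hT1 hX hXX hX1
    · rintro rfl
      obtain ⟨h, hh, h1⟩ := half_one_add_projection isHermitian_sigZ sigZ_mul_self trace_sigZ
      obtain ⟨hT, hTT, hT1⟩ := isHermitian_transpose_projection h hh h1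
      exact ⟨_, _, h, hh, h1, h, hh, h1, (pauli6_shadowNormSq hT hTT hT1 h hh h1).symm⟩
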